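/- Let B be a real N × M matrix and let y : ℝ → ℝ^N be twice differentiable with ÿ(t) = -(B Bᵀ) y(t) for all t. Define the block Hamiltonian H = -[[0, B],[Bᵀ, 0]], an (N+M) × (N+M) Hermitian matrix (with B viewed as a complex matrix), and define the complex (N+M)-dimensional vector-valued function ψ(t) whose first N components are ẏ(t) and whose last M components are i·(Bᵀ y(t)). Then ψ satisfies the Schrödinger equation dψ/dt = -i H ψ(t) for all t. -/

import Mathlib

open Matrix

/-- If `ÿ = -(B Bᵀ) y`, then the state `ψ` whose first `N` components are `ẏ`
and whose last `M` components are `i (Bᵀ y)` satisfies the Schrödinger equation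
`dψ/dt = -i H ψ` for the block Hamiltonian `H = -[[0, B],[Bᵀ, 0]]`. -/
theorem stmt_12 (N M : ℕ) (B : Matrix (Fin N) (Fin M) ℝ)
    (y y' : ℝ → Fin N → ℝ)
    (hy : ∀ t, HasDerivAt y (y' t) t)
    (hy' : ∀ t, HasDerivAt y' (-((B * Bᵀ).mulVec (y t))) t)
    (H : Matrix (Fin N ⊕ Fin M) (Fin N ⊕ Fin M) ℂ)
    (hH : H = -(Matrix.fromBlocks 0 (B.map (fun r => (r : ℂ)))
      (Bᵀ.map (fun r => (r : ℂ))) 0))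
    (ψ : ℝ → (Fin N ⊕ Fin M) → ℂ)
    (hψ : ∀ t, ψ t = Sum.elim (fun i => (y' t i : ℂ))
      (fun p => Complex.I * ((Bᵀ.mulVec (y t)) p : ℂ))) (t : ℝ) :
    HasDerivAt ψ ((-Complex.I) • H.mulVec (ψ t)) t := by
  have hψ' : ψ = fun t => Sum.elim (fun i => (y' t i : ℂ))
      (fun p => Complex.I * ((Bᵀ.mulVec (y t)) p : ℂ)) := funext hψ
  rw [hasDerivAt_pi]
  rintro (i | p)
  · have h1 := (hasDerivAt_pi.1 (hy' t) i).ofReal_comp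
    have e : ((-Complex.I) • H.mulVec (ψ t)) (Sum.inl i)
        = (((-((B * Bᵀ).mulVec (y t))) i : ℝ) : ℂ) := by
      rw [hψ t, hH, ← Matrix.mulVec_mulVec]
      simp only [Pi.smul_apply, Matrix.neg_mulVec, Pi.neg_apply, Matrix.fromBlocks_mulVec,
        Sum.elim_inl, Pi.add_apply, Matrix.zero_mulVec, Pi.zero_apply, zero_add, smul_eq_mul,
        neg_mul_neg, Complex.ofReal_neg]
      simp only [Matrix.mulVec, dotProduct, Matrix.map_apply, Function.comp, Sum.elim_inr]
      push_cast
      rw [Finset.mul_sum, ← Finset.sum_neg_distrib]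
      refine Finset.sum_congr rfl fun j _ => ?_
      linear_combination ((B i j : ℂ) * ∑ k, (Bᵀ j k : ℂ) * (y t k : ℂ)) * Complex.I_mul_I
    rw [e, hψ']
    exact h1
  · have h2 : HasDerivAt (fun s => (Bᵀ.mulVec (y s)) p) ((Bᵀ.mulVec (y' t)) p) t := by
      simp only [Matrix.mulVec, dotProduct]
      exact HasDerivAt.fun_sum fun k _ => (hasDerivAt_pi.1 (hy t) k).const_mul _
    have h3 := h2.ofReal_comp.const_mul Complex.I
    have e : ((-Complex.I) • H.mulVec (ψ t)) (Sum.inr p)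
        = Complex.I * ((Bᵀ.mulVec (y' t)) p : ℂ) := by
      rw [hψ t, hH]
      simp only [Pi.smul_apply, Matrix.neg_mulVec, Pi.neg_apply, Matrix.fromBlocks_mulVec,
        Sum.elim_inr, Pi.add_apply, Matrix.zero_mulVec, Pi.zero_apply, add_zero, smul_eq_mul,
        neg_mul_neg]
      simp only [Matrix.mulVec, dotProduct, Matrix.map_apply, Function.comp, Sum.elim_inl]
      push_cast
      rfl
    rw [e, hψ']
    exact h3
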